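/- arXiv:2306.09241 — 9 statements merged into one kernel-verified Lean document; each statement's English description precedes it below -/
import Mathlib

section
/- Let γ : I → ℝ³ be a differentiable curve with ⟨γ'(u), γ'(u)⟩ = 0 (Lorentz null) and γ₁'(u) ≠ 0 for all u ∈ I, let c : I → ℝ, and set L := c·γ'. Define α' := (1/2)(γ' − L) and β' := (1/2)(γ' + L). Then the formulas g₁ := −(γ₂' + γ₃')/γ₁', ω̂₁ := (γ₂' − γ₃')(1 − c)/4, g₂ := (γ₂' − γ₃')/γ₁', ω̂₂ := (γ₂' + γ₃')(1 + c)/4 satisfy, at every u ∈ I: α₁' = 2 g₁ ω̂₁, α₂' = (1 − g₁²) ω̂₁, α₃' = −(1 + g₁²) ω̂₁, β₁' = −2 g₂ ω̂₂, β₂' = (1 − g₂²) ω̂₂, β₃' = (1 + g₂²) ω̂₂. (In particular, since γ is null, γ₂' − γ₃' ≠ 0 and γ₂' + γ₃' ≠ 0 wherever γ₁' ≠ 0, and g₁ g₂ = 1.) -/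
/-- Weierstrass data of the minface in terms of the singular Björling data
`{γ, L = c·γ'}`: for a differentiable Lorentz-null curve `γ` with `γ₁' ≠ 0` and `L = c γ'`,
set `α' = (1/2)(γ' − L)`, `β' = (1/2)(γ' + L)`, `g₁ = −(γ₂' + γ₃')/γ₁'`,
`ω̂₁ = (γ₂' − γ₃')(1 − c)/4`, `g₂ = (γ₂' − γ₃')/γ₁'`, `ω̂₂ = (γ₂' + γ₃')(1 + c)/4`.
Then the six Weierstrass relations hold, and moreover `γ₂' − γ₃' ≠ 0`, `γ₂' + γ₃' ≠ 0`
and `g₁ g₂ = 1`. -/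
theorem stmt_5 (I : Set ℝ) (γ G : ℝ → (Fin 3 → ℝ)) (c : ℝ → ℝ)
    (hγ : ∀ t ∈ I, HasDerivAt γ (G t) t)
    (hnull : ∀ t ∈ I, G t 0 ^ 2 + G t 1 ^ 2 - G t 2 ^ 2 = 0)
    (h1 : ∀ t ∈ I, G t 0 ≠ 0) :
    ∀ u ∈ I,
      ((1/2 : ℝ) • (G u - c u • G u)) 0
          = 2 * (-(G u 1 + G u 2) / G u 0) * ((G u 1 - G u 2) * (1 - c u) / 4) ∧
      ((1/2 : ℝ) • (G u - c u • G u)) 1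
          = (1 - (-(G u 1 + G u 2) / G u 0) ^ 2) * ((G u 1 - G u 2) * (1 - c u) / 4) ∧
      ((1/2 : ℝ) • (G u - c u • G u)) 2
          = -(1 + (-(G u 1 + G u 2) / G u 0) ^ 2) * ((G u 1 - G u 2) * (1 - c u) / 4) ∧
      ((1/2 : ℝ) • (G u + c u • G u)) 0
          = -2 * ((G u 1 - G u 2) / G u 0) * ((G u 1 + G u 2) * (1 + c u) / 4) ∧
      ((1/2 : ℝ) • (G u + c u • G u)) 1
          = (1 - ((G u 1 - G u 2) / G u 0) ^ 2) * ((G u 1 + G u 2) * (1 + c u) / 4) ∧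
      ((1/2 : ℝ) • (G u + c u • G u)) 2
          = (1 + ((G u 1 - G u 2) / G u 0) ^ 2) * ((G u 1 + G u 2) * (1 + c u) / 4) ∧
      G u 1 - G u 2 ≠ 0 ∧ G u 1 + G u 2 ≠ 0 ∧
      (-(G u 1 + G u 2) / G u 0) * ((G u 1 - G u 2) / G u 0) = 1 := by
  intro u hu
  have hn := hnull u hu
  have hx := h1 u hu
  simp only [Pi.smul_apply, Pi.sub_apply, Pi.add_apply, smul_eq_mul]
  generalize G u 0 = x at *
  generalize G u 1 = y at *
  generalize G u 2 = z at *
  generalize c u = k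
  have hpq : (y + z) * (y - z) = -x ^ 2 := by linear_combination hn
  have hne : (y + z) * (y - z) ≠ 0 := by
    rw [hpq]
    exact neg_ne_zero.mpr (pow_ne_zero 2 hx)
  have e1 : -(y + z) / x * x = -(y + z) := div_mul_cancel₀ _ hx
  have e2 : (y - z) / x * x = y - z := div_mul_cancel₀ _ hx
  have e3 : -(y + z) / x * ((y - z) / x) = 1 := by
    field_simp
    linear_combination -hpq
  generalize -(y + z) / x = g₁ at *
  generalize (y - z) / x = g₂ at *
  refine ⟨?_, ?_, ?_, ?_, ?_, ?_, right_ne_zero_of_mul hne, left_ne_zero_of_mul hne, e3⟩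
  · linear_combination (1 - k) / 2 * (g₁ * e2 - x * e3)
  · linear_combination (1 - k) / 4 * (e1 - g₁ ^ 2 * e2 + g₁ * x * e3)
  · linear_combination (1 - k) / 4 * (e1 - g₁ ^ 2 * e2 + g₁ * x * e3)
  · linear_combination (1 + k) / 2 * (g₂ * e1 - x * e3)
  · linear_combination (1 + k) / 4 * (g₂ ^ 2 * e1 - e2 - g₂ * x * e3)
  · linear_combination -(1 + k) / 4 * (g₂ ^ 2 * e1 - e2 - g₂ * x * e3)
end

section
/- Let γ : I → ℝ³ be a twice differentiable curve with ⟨γ'(u), γ'(u)⟩ = 0 for all u in the open interval I (so that also ⟨γ'(u), γ''(u)⟩ = 0), with γ₁'(u) ≠ 0 for all u, and let c : I → ℝ be differentiable with c(u) ≠ 1 and c(u) ≠ −1 for all u. Set g₁ := −(γ₂' + γ₃')/γ₁', ω̂₁ := (γ₂' − γ₃')(1 − c)/4, g₂ := (γ₂' − γ₃')/γ₁', ω̂₂ := (γ₂' + γ₃')(1 + c)/4, and D := γ₂'γ₃'' − γ₃'γ₂''. Then at every u ∈ I: δ₁ := g₁'/(g₁² ω̂₁) = −4 D / (γ₁'³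 (1 − c)) and δ₂ := g₂'/(g₂² ω̂₂) = −4 D / (γ₁'³ (1 + c)). -/
theorem null_factor_div_weierstrass {p q x k D : ℝ} (hx : x ≠ 0) (hpq : p * q = -x ^ 2)
    (hk : k ≠ 0) :
    p * D / x ^ 3 / ((p / x) ^ 2 * (q * k / 4)) = -4 * D / (x ^ 3 * k) := by
  have hne : p * q ≠ 0 := by rw [hpq]; exact neg_ne_zero.mpr (pow_ne_zero 2 hx)
  have hp := left_ne_zero_of_mul hne
  have hq := right_ne_zero_of_mul hne
  field_simp
  linear_combination D * hpq

theorem null_curve_deriv_orthogonal {G : ℝ → (Fin 3 → ℝ)} {G' : Fin 3 → ℝ} {I : Set ℝ} {u : ℝ}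
    (hI : IsOpen I) (hu : u ∈ I) (hG : HasDerivAt G G' u)
    (hnull : ∀ t ∈ I, G t 0 ^ 2 + G t 1 ^ 2 - G t 2 ^ 2 = 0) :
    G u 0 * G' 0 + G u 1 * G' 1 - G u 2 * G' 2 = 0 := by
  have hcoord := hasDerivAt_pi.1 hG
  have hquad := (((hcoord 0).pow 2).add ((hcoord 1).pow 2)).sub ((hcoord 2).pow 2)
  have hzero : (fun t => G t 0) ^ 2 + (fun t => G t 1) ^ 2 - (fun t => G t 2) ^ 2
      =ᶠ[nhds u] fun _ => (0 : ℝ) := by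
    filter_upwards [hI.mem_nhds hu] with t ht
    exact hnull t ht
  have hderiv := hquad.unique ((hasDerivAt_const u (0 : ℝ)).congr_of_eventuallyEq hzero)
  norm_num at hderiv
  linarith


/-- The Weierstrass invariants `δ₁ = g₁'/(g₁²ω̂₁)` and `δ₂ = g₂'/(g₂²ω̂₂)`
of a minface in terms of the singular Björling data: for a twice differentiable null curve
`γ` on an open set `I` with `γ₁' ≠ 0`, and differentiable `c` with `c ≠ ±1`, where
`g₁ = −(γ₂' + γ₃')/γ₁'`, `ω̂₁ = (γ₂' − γ₃')(1 − c)/4`, `g₂ = (γ₂' − γ₃')/γ₁'`,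
`ω̂₂ = (γ₂' + γ₃')(1 + c)/4`, and `D = γ₂'γ₃'' − γ₃'γ₂''`, one has
`δ₁ = −4D/(γ₁'³(1 − c))` and `δ₂ = −4D/(γ₁'³(1 + c))`. -/
theorem stmt_6 (I : Set ℝ) (hI : IsOpen I)
    (γ G G2 : ℝ → (Fin 3 → ℝ)) (c c' : ℝ → ℝ)
    (hγ : ∀ t ∈ I, HasDerivAt γ (G t) t)
    (hG : ∀ t ∈ I, HasDerivAt G (G2 t) t)
    (hnull : ∀ t ∈ I, G t 0 ^ 2 + G t 1 ^ 2 - G t 2 ^ 2 = 0)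
    (h1 : ∀ t ∈ I, G t 0 ≠ 0)
    (hc : ∀ t ∈ I, HasDerivAt c (c' t) t)
    (hc1 : ∀ t ∈ I, c t ≠ 1) (hc2 : ∀ t ∈ I, c t ≠ -1) :
    ∀ u ∈ I,
      deriv (fun t => -(G t 1 + G t 2) / G t 0) u /
          ((-(G u 1 + G u 2) / G u 0) ^ 2 * ((G u 1 - G u 2) * (1 - c u) / 4))
        = -4 * (G u 1 * G2 u 2 - G u 2 * G2 u 1) / ((G u 0) ^ 3 * (1 - c u)) ∧
      deriv (fun t => (G t 1 - G t 2) / G t 0) u /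
          (((G u 1 - G u 2) / G u 0) ^ 2 * ((G u 1 + G u 2) * (1 + c u) / 4))
        = -4 * (G u 1 * G2 u 2 - G u 2 * G2 u 1) / ((G u 0) ^ 3 * (1 + c u)) := by
  intro u hu
  have hx := h1 u hu
  have hn := hnull u hu
  have horth := null_curve_deriv_orthogonal hI hu (hG u hu) hnull
  have hcoord := hasDerivAt_pi.1 (hG u hu)
  have hk₁ : 1 - c u ≠ 0 := sub_ne_zero.mpr (hc1 u hu).symm
  have hk₂ : 1 + c u ≠ 0 := fun h => hc2 u hu (by linarith)
  constructor
  · have hd : deriv (fun t => -(G t 1 + G t 2) / G t 0) u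
        = (G u 1 + G u 2) * (G u 1 * G2 u 2 - G u 2 * G2 u 1) / G u 0 ^ 3 := by
      refine ((((hcoord 1).add (hcoord 2)).neg).div (hcoord 0) hx).deriv.trans ?_
      simp only [Pi.neg_apply, Pi.add_apply]
      field_simp
      linear_combination (G u 1 + G u 2) * horth - (G2 u 1 + G2 u 2) * hn
    rw [hd, neg_div, neg_sq]
    exact null_factor_div_weierstrass hx (by linear_combination hn) hk₁
  · have hd : deriv (fun t => (G t 1 - G t 2) / G t 0) u
        = (G u 1 - G u 2) * (G u 1 * G2 u 2 - G u 2 * G2 u 1) / G u 0 ^ 3 := by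
      refine (((hcoord 1).sub (hcoord 2)).div (hcoord 0) hx).deriv.trans ?_
      simp only [Pi.sub_apply]
      field_simp
      linear_combination -(G u 1 - G u 2) * horth + (G2 u 1 - G2 u 2) * hn
    rw [hd]
    exact null_factor_div_weierstrass hx (by linear_combination hn) hk₂
end

section
/- (Cuspidal edge criterion in Björling data.) With notation as follows: γ : I → ℝ³ twice differentiable, ⟨γ', γ'⟩ = 0, γ₁' ≠ 0, γ₃' ≠ 0 on I; L₃ : I → ℝ with L₃² ≠ γ₃'² on I; c := L₃/γ₃'; D := γ₂'γ₃'' − γ₃'γ₂''; δ₁ := −4D/(γ₁'³(1−c)); δ₂ := −4D/(γ₁'³(1+c)). Then at each point u ∈ I, the two conditions δ₁(u) − δ₂(u) ≠ 0 and δ₁(u) + δ₂(u) ≠ 0 hold simultaneously if and only if L₃(u) ≠ 0 and D(u) ≠ 0. -/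
/-- The difference and the sum of `d / (a (1 - c))` and `d / (a (1 + c))` are both nonzero iff
`c` and `d` are. -/
theorem div_one_sub_sub_add_div_one_add_ne_zero_iff {K : Type*} [Field K] [NeZero (2 : K)]
    {a c d : K} (ha : a ≠ 0) (hsub : 1 - c ≠ 0) (hadd : 1 + c ≠ 0) :
    (d / (a * (1 - c)) - d / (a * (1 + c)) ≠ 0 ∧ d / (a * (1 - c)) + d / (a * (1 + c)) ≠ 0) ↔
      c ≠ 0 ∧ d ≠ 0 := by
  have h2 : (2 : K) ≠ 0 := two_ne_zero
  have hdiff : d / (a * (1 - c)) - d / (a * (1 + c)) =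
      2 * d * c / (a * (1 - c) * (1 + c)) := by
    field_simp
    ring
  have hsum : d / (a * (1 - c)) + d / (a * (1 + c)) =
      2 * d / (a * (1 - c) * (1 + c)) := by
    field_simp
    ring
  rw [hdiff, hsum]
  simp [ha, hsub, hadd, h2]
  tauto


/-- Cuspidal edge criterion in singular Björling data: with
`c = L₃/γ₃'`, `D = γ₂'γ₃'' − γ₃'γ₂''`, `δ₁ = −4D/(γ₁'³(1−c))`, `δ₂ = −4D/(γ₁'³(1+c))`,
assuming `γ` null, `γ₁' ≠ 0`, `γ₃' ≠ 0` and `L₃² ≠ γ₃'²`, the conditions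
`δ₁ − δ₂ ≠ 0` and `δ₁ + δ₂ ≠ 0` hold simultaneously iff `L₃ ≠ 0` and `D ≠ 0`. -/
theorem stmt_8 (I : Set ℝ) (γ G G2 : ℝ → (Fin 3 → ℝ)) (L₃ : ℝ → ℝ)
    (hγ : ∀ t ∈ I, HasDerivAt γ (G t) t)
    (hG : ∀ t ∈ I, HasDerivAt G (G2 t) t)
    (hnull : ∀ u ∈ I, G u 0 ^ 2 + G u 1 ^ 2 - G u 2 ^ 2 = 0)
    (h1 : ∀ u ∈ I, G u 0 ≠ 0) (h3 : ∀ u ∈ I, G u 2 ≠ 0)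
    (hL : ∀ u ∈ I, (L₃ u) ^ 2 ≠ (G u 2) ^ 2) :
    ∀ u ∈ I,
      (((-4 * (G u 1 * G2 u 2 - G u 2 * G2 u 1) / ((G u 0) ^ 3 * (1 - L₃ u / G u 2)))
          - (-4 * (G u 1 * G2 u 2 - G u 2 * G2 u 1) / ((G u 0) ^ 3 * (1 + L₃ u / G u 2)))
            ≠ 0) ∧
        ((-4 * (G u 1 * G2 u 2 - G u 2 * G2 u 1) / ((G u 0) ^ 3 * (1 - L₃ u / G u 2)))
          + (-4 * (G u 1 * G2 u 2 - G u 2 * G2 u 1) / ((G u 0) ^ 3 * (1 + L₃ u / G u 2)))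
            ≠ 0))
      ↔ (L₃ u ≠ 0 ∧ G u 1 * G2 u 2 - G u 2 * G2 u 1 ≠ 0) := by
  intro u hu
  have hz := h3 u hu
  have hsub : 1 - L₃ u / G u 2 ≠ 0 := fun h => hL u hu <| by
    rw [(div_eq_one_iff_eq hz).mp (sub_eq_zero.mp h).symm]
  have hadd : 1 + L₃ u / G u 2 ≠ 0 := fun h => hL u hu <| by
    rw [(div_eq_iff hz).mp (eq_neg_of_add_eq_zero_right h)]
    ring
  rw [div_one_sub_sub_add_div_one_add_ne_zero_iff (pow_ne_zero 3 (h1 u hu)) hsub hadd]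
  simp [hz]
end

section
/- (Third cuspidal crosscap condition in Björling data.) Let γ : I → ℝ³ be three times differentiable with ⟨γ'(u), γ'(u)⟩ = 0 and γ₁'(u) ≠ 0 for all u ∈ I, let c : I → ℝ be differentiable with |c| < 1 on I, set D := γ₂'γ₃'' − γ₃'γ₂'', g₁ := −(γ₂' + γ₃')/γ₁', g₂ := (γ₂' − γ₃')/γ₁', δ₁ := −4D/(γ₁'³(1−c)), δ₂ := −4D/(γ₁'³(1+c)). Let u₀ ∈ I be a point with c(u₀) = 0. Then δ₁'(u₀)·(g₂'(u₀)/g₂(u₀)) + δ₂'(u₀)·(g₁'(u₀)/g₁(u₀)) = −8 c'(u₀) D(u₀)² / γ₁'(u₀)⁵. In particular, if D(u₀) ≠ 0, then δ₁'(u₀)(g₂'/g₂)(u₀) + δ₂'(u₀)(g₁'/g₁)(u₀) ≠ 0 if and only if c'(u₀) ≠ 0. -/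
/-- `D(γ₂₃', γ₂₃'') = γ₂'γ₃'' − γ₃'γ₂''` as a function of the parameter, in terms of the
derivative `G = γ'` and second derivative `G2 = γ''`. -/
def Dfun (G G2 : ℝ → (Fin 3 → ℝ)) : ℝ → ℝ := fun u => G u 1 * G2 u 2 - G u 2 * G2 u 1

/-- `g₁ = −(γ₂' + γ₃')/γ₁'`. -/
noncomputable def g1fun (G : ℝ → (Fin 3 → ℝ)) : ℝ → ℝ := fun u => -(G u 1 + G u 2) / G u 0

/-- `g₂ = (γ₂' − γ₃')/γ₁'`. -/
noncomputable def g2fun (G : ℝ → (Fin 3 → ℝ)) : ℝ → ℝ := fun u => (G u 1 - G u 2) / G u 0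

/-- `δ₁ = −4D/(γ₁'³(1 − c))`. -/
noncomputable def delta1 (G G2 : ℝ → (Fin 3 → ℝ)) (c : ℝ → ℝ) : ℝ → ℝ :=
  fun u => -4 * Dfun G G2 u / ((G u 0) ^ 3 * (1 - c u))

/-- `δ₂ = −4D/(γ₁'³(1 + c))`. -/
noncomputable def delta2 (G G2 : ℝ → (Fin 3 → ℝ)) (c : ℝ → ℝ) : ℝ → ℝ :=
  fun u => -4 * Dfun G G2 u / ((G u 0) ^ 3 * (1 + c u))

/-- The derivative of the null condition `x² + y² = z²` along a curve. -/
theorem null_deriv_eq {I : Set ℝ} (hI : IsOpen I) {G : ℝ → (Fin 3 → ℝ)} {v : Fin 3 → ℝ}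
    (hnull : ∀ t ∈ I, G t 0 ^ 2 + G t 1 ^ 2 - G t 2 ^ 2 = 0) {u : ℝ} (hu : u ∈ I)
    (hG : HasDerivAt G v u) : G u 0 * v 0 + G u 1 * v 1 - G u 2 * v 2 = 0 := by
  have hG' := hasDerivAt_pi.1 hG
  have hd := (((hG' 0).fun_pow 2).fun_add ((hG' 1).fun_pow 2)).fun_sub ((hG' 2).fun_pow 2)
  have hzero : (fun t => G t 0 ^ 2 + G t 1 ^ 2 - G t 2 ^ 2) =ᶠ[nhds u] fun _ => 0 := by
    filter_upwards [hI.mem_nhds hu] with t ht using hnull t ht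
  have h := hd.unique ((hasDerivAt_const u (0 : ℝ)).congr_of_eventuallyEq hzero)
  norm_num at h
  linarith

/-- The logarithmic derivative of `g₂` along a null curve is `D / γ₁'²`. -/
theorem logDeriv_g2fun {G G2 : ℝ → (Fin 3 → ℝ)} {u : ℝ} (hG : HasDerivAt G (G2 u) u)
    (h0 : G u 0 ≠ 0) (hnull : G u 0 ^ 2 + G u 1 ^ 2 - G u 2 ^ 2 = 0)
    (hnull' : G u 0 * G2 u 0 + G u 1 * G2 u 1 - G u 2 * G2 u 2 = 0) :
    deriv (g2fun G) u / g2fun G u = Dfun G G2 u / G u 0 ^ 2 := by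
  have hG' := hasDerivAt_pi.1 hG
  have hd : HasDerivAt (g2fun G) _ u := ((hG' 1).fun_sub (hG' 2)).fun_div (hG' 0) h0
  have hne : G u 1 - G u 2 ≠ 0 := fun h => h0 (pow_eq_zero_iff two_ne_zero |>.1 (by
    linear_combination hnull - (G u 1 + G u 2) * h))
  rw [hd.deriv, g2fun, Dfun]
  field_simp
  linear_combination (G2 u 1 - G2 u 2) * hnull - (G u 1 - G u 2) * hnull'

/-- The logarithmic derivative of `g₁` along a null curve is `-D / γ₁'²`. -/
theorem logDeriv_g1fun {G G2 : ℝ → (Fin 3 → ℝ)} {u : ℝ} (hG : HasDerivAt G (G2 u) u)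
    (h0 : G u 0 ≠ 0) (hnull : G u 0 ^ 2 + G u 1 ^ 2 - G u 2 ^ 2 = 0)
    (hnull' : G u 0 * G2 u 0 + G u 1 * G2 u 1 - G u 2 * G2 u 2 = 0) :
    deriv (g1fun G) u / g1fun G u = -(Dfun G G2 u / G u 0 ^ 2) := by
  have hG' := hasDerivAt_pi.1 hG
  have hd : HasDerivAt (g1fun G) _ u := ((hG' 1).fun_add (hG' 2)).fun_neg.fun_div (hG' 0) h0
  have hne : G u 1 + G u 2 ≠ 0 := fun h => h0 (pow_eq_zero_iff two_ne_zero |>.1 (by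
    linear_combination hnull - (G u 1 - G u 2) * h))
  rw [hd.deriv, g1fun, Dfun]
  field_simp
  linear_combination (G2 u 1 + G2 u 2) * hnull - (G u 1 + G u 2) * hnull'

/-- Where `c` vanishes, the derivatives of `δ₁` and `δ₂` differ by `-8 c' D / γ₁'³`. -/
theorem deriv_delta1_sub_deriv_delta2 {G G2 : ℝ → (Fin 3 → ℝ)} {c : ℝ → ℝ} {v w : Fin 3 → ℝ}
    {a u : ℝ} (hG : HasDerivAt G v u) (hG2 : HasDerivAt G2 w u) (hc : HasDerivAt c a u)
    (h0 : G u 0 ≠ 0) (hc0 : c u = 0) :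
    deriv (delta1 G G2 c) u - deriv (delta2 G G2 c) u = -8 * a * Dfun G G2 u / G u 0 ^ 3 := by
  have hG' := hasDerivAt_pi.1 hG
  have hG2' := hasDerivAt_pi.1 hG2
  have hD : HasDerivAt (Dfun G G2) _ u :=
    ((hG' 1).fun_mul (hG2' 2)).fun_sub ((hG' 2).fun_mul (hG2' 1))
  have hd1 : HasDerivAt (delta1 G G2 c) _ u :=
    (hD.const_mul (-4)).fun_div (((hG' 0).fun_pow 3).fun_mul (hc.const_sub 1)) (by simp [hc0, h0])
  have hd2 : HasDerivAt (delta2 G G2 c) _ u :=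
    (hD.const_mul (-4)).fun_div (((hG' 0).fun_pow 3).fun_mul (hc.const_add 1)) (by simp [hc0, h0])
  rw [hd1.deriv, hd2.deriv]
  simp only [hc0, sub_zero, add_zero, mul_one]
  field_simp
  ring

/-- Third cuspidal crosscap condition in singular Björling data: for a
three times differentiable null curve `γ` with `γ₁' ≠ 0` on the open set `I`, and
differentiable `c` with `|c| < 1`, at a point `u₀ ∈ I` with `c(u₀) = 0` one has
`δ₁'(u₀)(g₂'/g₂)(u₀) + δ₂'(u₀)(g₁'/g₁)(u₀) = −8 c'(u₀) D(u₀)²/γ₁'(u₀)⁵`; in particular,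
if `D(u₀) ≠ 0`, this quantity is nonzero iff `c'(u₀) ≠ 0`. -/
theorem stmt_10 (I : Set ℝ) (hI : IsOpen I)
    (γ G G2 G3 : ℝ → (Fin 3 → ℝ)) (c c' : ℝ → ℝ)
    (hγ : ∀ t ∈ I, HasDerivAt γ (G t) t)
    (hG : ∀ t ∈ I, HasDerivAt G (G2 t) t)
    (hG2 : ∀ t ∈ I, HasDerivAt G2 (G3 t) t)
    (hnull : ∀ t ∈ I, G t 0 ^ 2 + G t 1 ^ 2 - G t 2 ^ 2 = 0)
    (h1 : ∀ t ∈ I, G t 0 ≠ 0)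
    (hc : ∀ t ∈ I, HasDerivAt c (c' t) t)
    (hcsmall : ∀ t ∈ I, |c t| < 1)
    (u₀ : ℝ) (hu₀ : u₀ ∈ I) (hc0 : c u₀ = 0) :
    deriv (delta1 G G2 c) u₀ * (deriv (g2fun G) u₀ / g2fun G u₀)
        + deriv (delta2 G G2 c) u₀ * (deriv (g1fun G) u₀ / g1fun G u₀)
      = -8 * c' u₀ * (Dfun G G2 u₀) ^ 2 / (G u₀ 0) ^ 5 ∧
    (Dfun G G2 u₀ ≠ 0 →
      (deriv (delta1 G G2 c) u₀ * (deriv (g2fun G) u₀ / g2fun G u₀)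
          + deriv (delta2 G G2 c) u₀ * (deriv (g1fun G) u₀ / g1fun G u₀) ≠ 0
        ↔ c' u₀ ≠ 0)) := by
  have hnull' := null_deriv_eq hI hnull hu₀ (hG u₀ hu₀)
  have h0 := h1 u₀ hu₀
  have key : deriv (delta1 G G2 c) u₀ * (deriv (g2fun G) u₀ / g2fun G u₀)
        + deriv (delta2 G G2 c) u₀ * (deriv (g1fun G) u₀ / g1fun G u₀)
      = -8 * c' u₀ * (Dfun G G2 u₀) ^ 2 / (G u₀ 0) ^ 5 := by
    rw [logDeriv_g2fun (hG u₀ hu₀) h0 (hnull u₀ hu₀) hnull',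
      logDeriv_g1fun (hG u₀ hu₀) h0 (hnull u₀ hu₀) hnull', mul_neg, ← sub_eq_add_neg, ← sub_mul,
      deriv_delta1_sub_deriv_delta2 (hG u₀ hu₀) (hG2 u₀ hu₀) (hc u₀ hu₀) h0 hc0]
    field_simp
  refine ⟨key, fun hD => ?_⟩
  rw [key]
  simp [hD, h0]
end

section
/- (Time-like helicoid.) Define X : ℝ² → ℝ³ by X(u,v) := (cos u · cos v, sin u · cos v, u) and γ(u) := (cos u, sin u, u). Then: (i) X(u,0) = γ(u) and ∂X/∂v (u,0) = 0 for all u; (ii) X satisfies the wave equation ∂²X/∂u² − ∂²X/∂v² = 0 everywhere; (iii) ⟨X_u, X_u⟩ = −sin²v, ⟨X_v, X_v⟩ = sin²v and ⟨X_u, X_v⟩ = 0 at every (u,v), where X_u := ∂X/∂u, X_v := ∂X/∂v; in particular ⟨X_u, X_u⟩ + ⟨X_v, X_v⟩ = 0 and the induced metric degenerates exactly where sin v = 0. -/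
/-- The Lorentz inner product on `ℝ³`: `⟨x,y⟩ = x₁y₁ + x₂y₂ − x₃y₃`. -/
def lprod (x y : Fin 3 → ℝ) : ℝ := x 0 * y 0 + x 1 * y 1 - x 2 * y 2

theorem HasDerivAt.vec3 {f g h : ℝ → ℝ} {f' g' h' t : ℝ} (hf : HasDerivAt f f' t)
    (hg : HasDerivAt g g' t) (hh : HasDerivAt h h' t) :
    HasDerivAt (fun s => ![f s, g s, h s]) ![f', g', h'] t := by
  rw [hasDerivAt_pi]
  intro i
  fin_cases i
  · exact hf
  · exact hg
  · exact hh

/-- The time-like helicoid `X(u,v) = (cos u cos v, sin u cos v, u)` with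
`γ(u) = (cos u, sin u, u)` satisfies: (i) `X(u,0) = γ(u)` and `∂X/∂v(u,0) = 0`;
(ii) the wave equation `X_{uu} − X_{vv} = 0`; (iii) `⟨X_u,X_u⟩ = −sin²v`,
`⟨X_v,X_v⟩ = sin²v`, `⟨X_u,X_v⟩ = 0`; in particular `⟨X_u,X_u⟩ + ⟨X_v,X_v⟩ = 0` and the
induced metric degenerates exactly where `sin v = 0`. -/
theorem stmt_12 (X : ℝ → ℝ → (Fin 3 → ℝ)) (γ : ℝ → (Fin 3 → ℝ))
    (hX : ∀ u v : ℝ, X u v = ![Real.cos u * Real.cos v, Real.sin u * Real.cos v, u])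
    (hγ : ∀ u : ℝ, γ u = ![Real.cos u, Real.sin u, u]) :
    (∀ u : ℝ, X u 0 = γ u ∧ HasDerivAt (fun v => X u v) (0 : Fin 3 → ℝ) 0) ∧
    (∀ u v : ℝ, deriv (fun u' => deriv (fun u'' => X u'' v) u') u
        - deriv (fun v' => deriv (fun v'' => X u v'') v') v = 0) ∧
    (∀ u v : ℝ,
      lprod (deriv (fun u' => X u' v) u) (deriv (fun u' => X u' v) u) = -(Real.sin v ^ 2) ∧
      lprod (deriv (fun v' => X u v') v) (deriv (fun v' => X u v') v) = Real.sin v ^ 2 ∧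
      lprod (deriv (fun u' => X u' v) u) (deriv (fun v' => X u v') v) = 0) ∧
    (∀ u v : ℝ,
      lprod (deriv (fun u' => X u' v) u) (deriv (fun u' => X u' v) u)
        + lprod (deriv (fun v' => X u v') v) (deriv (fun v' => X u v') v) = 0) ∧
    (∀ u v : ℝ,
      lprod (deriv (fun u' => X u' v) u) (deriv (fun u' => X u' v) u) = 0 ↔
        Real.sin v = 0) := by
  obtain rfl : X = fun u v => ![Real.cos u * Real.cos v, Real.sin u * Real.cos v, u] :=
    funext₂ hX
  have hv : ∀ u v : ℝ, HasDerivAt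
      (fun v => ![Real.cos u * Real.cos v, Real.sin u * Real.cos v, u])
      ![Real.cos u * -Real.sin v, Real.sin u * -Real.sin v, 0] v := fun u v =>
    ((Real.hasDerivAt_cos v).const_mul _).vec3 ((Real.hasDerivAt_cos v).const_mul _)
      (hasDerivAt_const v u)
  have hu : ∀ u v : ℝ, HasDerivAt
      (fun u => ![Real.cos u * Real.cos v, Real.sin u * Real.cos v, u])
      ![-Real.sin u * Real.cos v, Real.cos u * Real.cos v, 1] u := fun u v =>
    ((Real.hasDerivAt_cos u).mul_const _).vec3 ((Real.hasDerivAt_sin u).mul_const _)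
      (hasDerivAt_id u)
  have huu : ∀ u v : ℝ, HasDerivAt
      (fun u => ![-Real.sin u * Real.cos v, Real.cos u * Real.cos v, 1])
      ![-Real.cos u * Real.cos v, -Real.sin u * Real.cos v, 0] u := fun u v =>
    ((Real.hasDerivAt_sin u).neg.mul_const _).vec3 ((Real.hasDerivAt_cos u).mul_const _)
      (hasDerivAt_const u 1)
  have hvv : ∀ u v : ℝ, HasDerivAt
      (fun v => ![Real.cos u * -Real.sin v, Real.sin u * -Real.sin v, 0])
      ![Real.cos u * -Real.cos v, Real.sin u * -Real.cos v, 0] v := fun u v =>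
    ((Real.hasDerivAt_sin v).neg.const_mul _).vec3 ((Real.hasDerivAt_sin v).neg.const_mul _)
      (hasDerivAt_const v 0)
  have euu : ∀ u v : ℝ,
      lprod ![-Real.sin u * Real.cos v, Real.cos u * Real.cos v, 1]
        ![-Real.sin u * Real.cos v, Real.cos u * Real.cos v, 1] = -(Real.sin v ^ 2) := by
    intro u v
    simp only [lprod, Matrix.cons_val]
    linear_combination Real.cos v ^ 2 * Real.sin_sq_add_cos_sq u + Real.sin_sq_add_cos_sq v
  have evv : ∀ u v : ℝ,
      lprod ![Real.cos u * -Real.sin v, Real.sin u * -Real.sin v, 0]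
        ![Real.cos u * -Real.sin v, Real.sin u * -Real.sin v, 0] = Real.sin v ^ 2 := by
    intro u v
    simp only [lprod, Matrix.cons_val]
    linear_combination Real.sin v ^ 2 * Real.sin_sq_add_cos_sq u
  simp only [(hu _ _).deriv, (hv _ _).deriv, (huu _ _).deriv, (hvv _ _).deriv, euu, evv]
  refine ⟨fun u => ⟨by simp [hγ], ?_⟩, fun u v => ?_, fun u v => ⟨trivial, trivial, ?_⟩,
    fun u v => neg_add_cancel _, fun u v => by simp⟩
  · convert hv u 0 using 1
    ext i
    fin_cases i <;> simp
  · simp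
  · simp only [lprod, Matrix.cons_val]
    ring
end

section
/- (Zeros and nonvanishing derivative of the perturbation fields.) Let γ : ℝ → ℝ³ be C¹ with derivative γ', let r > 0, n ≥ 1, and define L_n(t) := γ'(t) · (1/(n (r+1)ⁿ)) · ∏_{i=1}^{n} (t − 1/i). Then for every k ∈ {1, …, n}: (i) L_n(1/k) = 0; (ii) L_n'(1/k) = γ'(1/k) · (1/(n (r+1)ⁿ)) · ∏_{i=1, i≠k}^{n} (1/k − 1/i); in particular, if γ'(1/k) ≠ 0 then L_n'(1/k) ≠ 0. Hence if γ is a null curve with γ'(1/k) ≠ 0 and γ₂'γ₃'' − γ₃'γ₂'' ≠ 0 at t = 1/k, the singular Björling data {γ, L_n} satisfies at t = 1/k the cuspidal crosscap criterion: γ' ≠ 0, L_n = 0, L_n' ≠ 0, D(γ₂₃', γ₂₃'') ≠ 0. -/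
/-- A multiple of `t - a` by a function continuous at `a` is differentiable at `a`. -/
theorem hasDerivAt_sub_smul_of_continuousAt {E : Type*} [NormedAddCommGroup E] [NormedSpace ℝ E]
    {H : ℝ → E} {a : ℝ} (hH : ContinuousAt H a) :
    HasDerivAt (fun t => (t - a) • H t) (H a) a := by
  rw [hasDerivAt_iff_tendsto_slope]
  refine (hH.tendsto.mono_left nhdsWithin_le_nhds).congr' ?_
  filter_upwards [self_mem_nhdsWithin] with t ht
  have hta : t - a ≠ 0 := sub_ne_zero.mpr ht
  simp [slope_def_module, smul_smul, inv_mul_cancel₀ hta]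

/-- The reciprocals of distinct natural numbers are distinct, so the product of their differences
does not vanish. -/
theorem prod_erase_one_div_sub_one_div_ne_zero (s : Finset ℕ) (k : ℕ) :
    ∏ i ∈ s.erase k, (1 / (k : ℝ) - 1 / (i : ℝ)) ≠ 0 := by
  refine Finset.prod_ne_zero_iff.mpr fun i hi h => Finset.ne_of_mem_erase hi ?_
  simpa using (sub_eq_zero.mp h).symm

/-- Zeros and nonvanishing derivative of the perturbation fields: for
`γ` of class `C¹`, `r > 0`, `n ≥ 1` and
`Lₙ(t) = γ'(t)·(1/(n(r+1)ⁿ))·∏_{i=1}^{n}(t − 1/i)`, for each `1 ≤ k ≤ n`: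
(i) `Lₙ(1/k) = 0`; (ii) `Lₙ'(1/k) = γ'(1/k)·(1/(n(r+1)ⁿ))·∏_{i≠k}(1/k − 1/i)`, which is
nonzero whenever `γ'(1/k) ≠ 0`. Hence if `γ` is a null curve with `γ'(1/k) ≠ 0` and
`D(γ₂₃',γ₂₃'')(1/k) ≠ 0`, the data `{γ, Lₙ}` satisfies the cuspidal crosscap criterion
`γ' ≠ 0`, `Lₙ = 0`, `Lₙ' ≠ 0`, `D ≠ 0` at `t = 1/k`. -/
theorem stmt_15 (γ G : ℝ → (Fin 3 → ℝ))
    (hγ : ∀ t : ℝ, HasDerivAt γ (G t) t) (hG : Continuous G)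
    (r : ℝ) (hr : 0 < r) (n : ℕ) (hn : 1 ≤ n)
    (Ln : ℝ → (Fin 3 → ℝ))
    (hLn : ∀ t : ℝ, Ln t =
      ((1 : ℝ) / ((n : ℝ) * (r + 1) ^ n) *
        ∏ i ∈ Finset.Icc 1 n, (t - 1 / (i : ℝ))) • G t)
    (k : ℕ) (hk : k ∈ Finset.Icc 1 n) :
    Ln (1 / (k : ℝ)) = 0 ∧
    HasDerivAt Ln
      (((1 : ℝ) / ((n : ℝ) * (r + 1) ^ n) *
        ∏ i ∈ (Finset.Icc 1 n).erase k, (1 / (k : ℝ) - 1 / (i : ℝ))) • G (1 / (k : ℝ)))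
      (1 / (k : ℝ)) ∧
    (G (1 / (k : ℝ)) ≠ 0 →
      ((1 : ℝ) / ((n : ℝ) * (r + 1) ^ n) *
        ∏ i ∈ (Finset.Icc 1 n).erase k, (1 / (k : ℝ) - 1 / (i : ℝ))) • G (1 / (k : ℝ))
        ≠ 0) ∧
    (∀ G2 : Fin 3 → ℝ,
      (∀ j : Fin 3, HasDerivAt (fun t => G t j) (G2 j) (1 / (k : ℝ))) →
      (∀ t : ℝ, lprod (G t) (G t) = 0) →
      G (1 / (k : ℝ)) ≠ 0 →
      G (1 / (k : ℝ)) 1 * G2 2 - G (1 / (k : ℝ)) 2 * G2 1 ≠ 0 →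
        (G (1 / (k : ℝ)) ≠ 0 ∧ Ln (1 / (k : ℝ)) = 0 ∧
          (∃ V : Fin 3 → ℝ, HasDerivAt Ln V (1 / (k : ℝ)) ∧ V ≠ 0) ∧
          G (1 / (k : ℝ)) 1 * G2 2 - G (1 / (k : ℝ)) 2 * G2 1 ≠ 0)) := by
  have hzero : Ln (1 / (k : ℝ)) = 0 := by
    rw [hLn, Finset.prod_eq_zero hk (sub_self _), mul_zero, zero_smul]
  have hderiv : HasDerivAt Ln
      (((1 : ℝ) / ((n : ℝ) * (r + 1) ^ n) *
        ∏ i ∈ (Finset.Icc 1 n).erase k, (1 / (k : ℝ) - 1 / (i : ℝ))) • G (1 / (k : ℝ)))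
      (1 / (k : ℝ)) := by
    have hcont : Continuous fun t : ℝ => ((1 : ℝ) / ((n : ℝ) * (r + 1) ^ n) *
        ∏ i ∈ (Finset.Icc 1 n).erase k, (t - 1 / (i : ℝ))) • G t := by
      fun_prop
    refine (hasDerivAt_sub_smul_of_continuousAt hcont.continuousAt).congr_of_eventuallyEq
      (Filter.Eventually.of_forall fun t => ?_)
    simp only [hLn, ← Finset.mul_prod_erase _ _ hk, smul_smul]
    congr 1
    ring
  have hne : G (1 / (k : ℝ)) ≠ 0 →
      ((1 : ℝ) / ((n : ℝ) * (r + 1) ^ n) *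
        ∏ i ∈ (Finset.Icc 1 n).erase k, (1 / (k : ℝ) - 1 / (i : ℝ))) • G (1 / (k : ℝ))
        ≠ 0 := by
    have hn0 : (n : ℝ) ≠ 0 := Nat.cast_ne_zero.mpr (by lia)
    have hconst : (1 : ℝ) / ((n : ℝ) * (r + 1) ^ n) ≠ 0 := by positivity
    exact smul_ne_zero (mul_ne_zero hconst (prod_erase_one_div_sub_one_div_ne_zero _ k))
  exact ⟨hzero, hderiv, hne, fun _ _ _ hGk hD => ⟨hGk, hzero, ⟨_, hderiv, hne hGk⟩, hD⟩⟩
end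

section
/- (Uniform convergence of the minface sequence.) Let γ : ℝ → ℝ³ be C¹, let r > 0, and for n ≥ 1 define L_n(s) := γ'(s) · (1/(n (r+1)ⁿ)) · ∏_{i=1}^{n} (s − 1/i), X_n(u,v) := (1/2)(γ(u+v) + γ(u−v)) + (1/2)∫_{u−v}^{u+v} L_n(s) ds, and X(u,v) := (1/2)(γ(u+v) + γ(u−v)). Let M := sup_{s ∈ [−r,r]} max_j |γ_j'(s)|. Then for every (u,v) with u+v ∈ [−r,r] and u−v ∈ [−r,r], max_j |X_{n,j}(u,v) − X_j(u,v)| ≤ r·M/n. In particular X_n converges to X uniformly (in the norm ‖·‖_Ω) on any set Ω contained in {(u,v) : |u±v| ≤ r}. -/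
/-- On `[-r, r]` the normalised product `(r + 1)⁻ⁿ ∏ (s - 1/i)`, divided by `n`, is at most `1/n`. -/
theorem abs_normalized_prod_sub_inv_le {r s : ℝ} (hr : 0 ≤ r) (hs : |s| ≤ r) (n : ℕ) :
    |(1 : ℝ) / ((n : ℝ) * (r + 1) ^ n) * ∏ i ∈ Finset.Icc 1 n, (s - 1 / (i : ℝ))| ≤ 1 / n := by
  have hprod : |∏ i ∈ Finset.Icc 1 n, (s - 1 / (i : ℝ))| ≤ (r + 1) ^ n := by
    rw [Finset.abs_prod]
    calc ∏ i ∈ Finset.Icc 1 n, |s - 1 / (i : ℝ)| ≤ ∏ _i ∈ Finset.Icc 1 n, (r + 1) := by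
          refine Finset.prod_le_prod (fun _ _ => abs_nonneg _) fun i hi => ?_
          have hi1 : (1 : ℝ) ≤ i := by exact_mod_cast (Finset.mem_Icc.mp hi).1
          have hinv : |1 / (i : ℝ)| ≤ 1 := by
            rw [abs_of_nonneg (by positivity)]
            exact (div_le_one (by linarith)).mpr hi1
          exact (abs_sub _ _).trans (add_le_add hs hinv)
      _ = (r + 1) ^ n := by simp
  have hpow : (0 : ℝ) < (r + 1) ^ n := by positivity
  rw [abs_mul, abs_of_nonneg (by positivity : 0 ≤ (1 : ℝ) / ((n : ℝ) * (r + 1) ^ n))]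
  calc (1 : ℝ) / ((n : ℝ) * (r + 1) ^ n) * |∏ i ∈ Finset.Icc 1 n, (s - 1 / (i : ℝ))|
      ≤ 1 / ((n : ℝ) * (r + 1) ^ n) * (r + 1) ^ n := by gcongr
    _ = 1 / n := by
      rw [one_div, mul_inv, mul_assoc, inv_mul_cancel₀ hpow.ne', mul_one, one_div]

/-- Uniform convergence of the minface sequence: with
`Lₙ(s) = γ'(s)·(1/(n(r+1)ⁿ))·∏_{i=1}^{n}(s − 1/i)`,
`Xₙ(u,v) = (1/2)(γ(u+v) + γ(u−v)) + (1/2)∫_{u−v}^{u+v} Lₙ` and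
`X(u,v) = (1/2)(γ(u+v) + γ(u−v))`, if `M` bounds `max_j |γⱼ'|` on `[−r,r]`, then for
all `(u,v)` with `u±v ∈ [−r,r]` and every component `j`,
`|Xₙⱼ(u,v) − Xⱼ(u,v)| ≤ rM/n`; in particular `Xₙ → X` uniformly as `rM/n → 0`. -/
theorem stmt_16 (γ G : ℝ → (Fin 3 → ℝ))
    (hγ : ∀ t : ℝ, HasDerivAt γ (G t) t) (hG : Continuous G)
    (r : ℝ) (hr : 0 < r) (M : ℝ)
    (hM : ∀ s ∈ Set.Icc (-r) r, ∀ j : Fin 3, |G s j| ≤ M) :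
    (∀ n : ℕ, 1 ≤ n → ∀ u v : ℝ,
      u + v ∈ Set.Icc (-r) r → u - v ∈ Set.Icc (-r) r → ∀ j : Fin 3,
      |(((1/2 : ℝ) • (γ (u + v) + γ (u - v)) +
            (1/2 : ℝ) • ∫ s in (u - v)..(u + v),
              ((1 : ℝ) / ((n : ℝ) * (r + 1) ^ n) *
                ∏ i ∈ Finset.Icc 1 n, (s - 1 / (i : ℝ))) • G s) -
          (1/2 : ℝ) • (γ (u + v) + γ (u - v))) j| ≤ r * M / n) ∧
    Filter.Tendsto (fun n : ℕ => r * M / n) Filter.atTop (nhds 0) := by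
  refine ⟨fun n _ u v hu hv j => ?_, tendsto_const_div_atTop_nhds_zero_nat _⟩
  have hM0 : 0 ≤ M := (abs_nonneg _).trans (hM 0 ⟨by linarith, hr.le⟩ 0)
  have hbound : ∀ s ∈ Set.uIoc (u - v) (u + v),
      ‖((1 : ℝ) / ((n : ℝ) * (r + 1) ^ n) *
        ∏ i ∈ Finset.Icc 1 n, (s - 1 / (i : ℝ))) • G s‖ ≤ 1 / n * M := by
    intro s hs
    have hs' : s ∈ Set.Icc (-r) r := Set.uIcc_subset_Icc hv hu (Set.uIoc_subset_uIcc hs)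
    rw [norm_smul]
    exact mul_le_mul (abs_normalized_prod_sub_inv_le hr.le (abs_le.mpr hs') n)
      ((pi_norm_le_iff_of_nonneg hM0).mpr (hM s hs')) (norm_nonneg _) (by positivity)
  have hint := intervalIntegral.norm_integral_le_of_norm_le_const hbound
  have hlen : |u + v - (u - v)| ≤ 2 * r :=
    abs_le.mpr ⟨by linarith [hu.1, hv.2], by linarith [hu.2, hv.1]⟩
  rw [add_sub_cancel_left, Pi.smul_apply, smul_eq_mul, abs_mul,
    abs_of_pos (by norm_num : (0 : ℝ) < 1 / 2)]
  have hj := ((norm_le_pi_norm _ j).trans hint).trans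
    (mul_le_mul_of_nonneg_left hlen (by positivity))
  rw [Real.norm_eq_abs] at hj
  calc _ ≤ 1 / 2 * (1 / n * M * (2 * r)) := mul_le_mul_of_nonneg_left hj (by norm_num)
    _ = r * M / n := by ring
end

section
/- (Björling maxface: initial conditions, reality and harmonicity.) Let γ, L : ℂ → ℂ³ be holomorphic maps that take real values on the real axis (γ(ℝ) ⊆ ℝ³, L(ℝ) ⊆ ℝ³). Define X(u,v) := (1/2)(γ(u+iv) + γ(u−iv)) − (i/2)∫_{[u−iv, u+iv]} L(w) dw, where the integral is the complex line integral along the segment from u−iv to u+iv. Then: (i) X(u,v) ∈ ℝ³ for all (u,v) ∈ ℝ²; (ii) X(u,0) = γ(u) and ∂X/∂v (u,0) = L(u) for all u ∈ ℝ; (iii) each component of X is a harmonic function of (u,v): ∂²X/∂u² + ∂²X/∂v² = 0. -/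
open scoped ComplexConjugate

/-- Schwarz reflection for an entire function that is real on the real axis. -/
theorem Differentiable.apply_conj_of_im_ofReal_eq_zero {f : ℂ → ℂ} (hf : Differentiable ℂ f)
    (hreal : ∀ x : ℝ, (f x).im = 0) (z : ℂ) : f (conj z) = conj (f z) := by
  have hg : Differentiable ℂ (conj ∘ f ∘ conj) := fun w =>
    differentiableAt_conj_conj_iff.2 (hf _)
  have hfreq : ∃ᶠ w in nhdsWithin (0 : ℂ) {0}ᶜ, f w = (conj ∘ f ∘ conj) w := by
    have ht : Filter.Tendsto (fun x : ℝ => (x : ℂ)) (nhdsWithin 0 {0}ᶜ)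
        (nhdsWithin (0 : ℂ) {0}ᶜ) := by
      refine tendsto_nhdsWithin_iff.2 ⟨?_, ?_⟩
      · exact (Complex.continuous_ofReal.tendsto' 0 0 Complex.ofReal_zero).mono_left
          nhdsWithin_le_nhds
      · filter_upwards [self_mem_nhdsWithin] with x hx
        simpa using hx
    refine ht.frequently (Filter.Frequently.of_forall fun x => ?_)
    simp only [Function.comp_apply, Complex.conj_ofReal]
    exact (Complex.conj_eq_iff_im.2 (hreal x)).symm
  have hfg : f = conj ∘ f ∘ conj :=
    AnalyticOnNhd.eq_of_frequently_eq (fun w _ => hf.analyticAt w) (fun w _ => hg.analyticAt w)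
      hfreq
  simpa using congrFun hfg (conj z)

/-- Reality of integrals, over centered vertical segments, of reflection-symmetric functions. -/
theorem intervalIntegral_vertical_im_eq_zero {f : ℂ → ℂ} (hf : ∀ z, f (conj z) = conj (f z))
    (u v : ℝ) : (∫ s in (-v)..v, f ((u : ℂ) + s * Complex.I)).im = 0 := by
  rw [← Complex.conj_eq_iff_im, ← intervalIntegral.intervalIntegral_conj]
  have h : ∀ s : ℝ, conj (f ((u : ℂ) + s * Complex.I)) =
      (fun t : ℝ => f ((u : ℂ) + t * Complex.I)) (-s) := by
    intro s
    rw [← hf]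
    simp
  simp_rw [h]
  rw [intervalIntegral.integral_comp_neg (fun t : ℝ => f ((u : ℂ) + t * Complex.I)), neg_neg]

section

variable {E : Type*} [NormedAddCommGroup E] [NormedSpace ℂ E]

/-- The derivative of an entire function along a real line in `ℂ`. -/
theorem hasDerivAt_comp_real_line {f : ℂ → E} (hf : Differentiable ℂ f)
    (a b : ℂ) (t : ℝ) :
    HasDerivAt (fun s : ℝ => f (a + s * b)) (b • deriv f (a + t * b)) t := by
  have hline : HasDerivAt (fun s : ℝ => a + s * b) b t := by
    simpa using ((Complex.ofRealCLM.hasDerivAt (x := t)).mul_const b).const_add a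
  exact HasDerivAt.scomp t (hf (a + t * b)).hasDerivAt hline

/-- The first derivative of a sum of entire functions along two real lines. -/
theorem deriv_comp_real_line_add {f g : ℂ → E} (hf : Differentiable ℂ f)
    (hg : Differentiable ℂ g) (a b c d : ℂ) (t : ℝ) :
    deriv (fun s : ℝ => f (a + s * b) + g (c + s * d)) t =
      b • deriv f (a + t * b) + d • deriv g (c + t * d) :=
  ((hasDerivAt_comp_real_line hf a b t).add (hasDerivAt_comp_real_line hg c d t)).deriv

/-- The second derivative of a sum of entire functions along two real lines. -/
theorem deriv_deriv_comp_real_line_add [CompleteSpace E] {f g : ℂ → E}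
    (hf : Differentiable ℂ f) (hg : Differentiable ℂ g) (a b c d : ℂ) (t : ℝ) :
    deriv (fun r : ℝ => deriv (fun s : ℝ => f (a + s * b) + g (c + s * d)) r) t =
      b ^ 2 • deriv (deriv f) (a + t * b) + d ^ 2 • deriv (deriv g) (c + t * d) := by
  have hf' : Differentiable ℂ (deriv f) := fun z => (hf.analyticAt z).deriv.differentiableAt
  have hg' : Differentiable ℂ (deriv g) := fun z => (hg.analyticAt z).deriv.differentiableAt
  simp_rw [deriv_comp_real_line_add hf hg]
  rw [sq, sq, mul_smul, mul_smul]
  exact (((hasDerivAt_comp_real_line hf' a b t).const_smul b).add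
    ((hasDerivAt_comp_real_line hg' c d t).const_smul d)).deriv

/-- Integral along a vertical segment, in terms of a primitive. -/
theorem I_smul_intervalIntegral_vertical [CompleteSpace E] {f P : ℂ → E} (hf : Continuous f)
    (hP : ∀ z, HasDerivAt P (f z) z) (u v : ℝ) :
    Complex.I • ∫ s in (-v)..v, f ((u : ℂ) + s * Complex.I) =
      P ((u : ℂ) + v * Complex.I) - P ((u : ℂ) - v * Complex.I) := by
  have hPd : Differentiable ℂ P := fun z => (hP z).differentiableAt
  have hderiv : deriv P = f := funext fun z => (hP z).deriv
  rw [← intervalIntegral.integral_smul]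
  rw [intervalIntegral.integral_eq_sub_of_hasDerivAt
    (f := fun s : ℝ => P ((u : ℂ) + s * Complex.I))]
  · simp [sub_eq_add_neg]
  · intro t _
    simpa [hderiv] using hasDerivAt_comp_real_line hPd u Complex.I t
  · exact Continuous.intervalIntegrable (by fun_prop) _ _

end


/-- Björling maxface: initial conditions, reality and harmonicity. For
holomorphic `γ, L : ℂ → ℂ³` taking real values on the real axis, the map
`X(u,v) = (1/2)(γ(u+iv) + γ(u−iv)) − (i/2)∫_{[u−iv,u+iv]} L(w) dw` (the complex line
integral along the vertical segment, parametrized as `i·∫_{−v}^{v} L(u+is) ds`) satisfies: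
(i) `X` is real-valued; (ii) `X(u,0) = γ(u)` and `∂X/∂v(u,0) = L(u)`; (iii) each
component of `X` is harmonic in `(u,v)`. -/
theorem stmt_17 (γ L : ℂ → (Fin 3 → ℂ))
    (hγ : Differentiable ℂ γ) (hL : Differentiable ℂ L)
    (hγreal : ∀ x : ℝ, ∀ j : Fin 3, (γ (x : ℂ) j).im = 0)
    (hLreal : ∀ x : ℝ, ∀ j : Fin 3, (L (x : ℂ) j).im = 0)
    (X : ℝ → ℝ → (Fin 3 → ℂ))
    (hX : ∀ u v : ℝ, X u v =
      (1/2 : ℂ) • (γ ((u : ℂ) + v * Complex.I) + γ ((u : ℂ) - v * Complex.I))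
        - (Complex.I / 2) •
            (Complex.I • ∫ s in (-v)..v, L ((u : ℂ) + s * Complex.I))) :
    (∀ u v : ℝ, ∀ j : Fin 3, (X u v j).im = 0) ∧
    (∀ u : ℝ, X u 0 = γ (u : ℂ)) ∧
    (∀ u : ℝ, HasDerivAt (fun v => X u v) (L (u : ℂ)) 0) ∧
    (∀ u v : ℝ, deriv (fun u' => deriv (fun u'' => X u'' v) u') u
        + deriv (fun v' => deriv (fun v'' => X u v'') v') v = 0) := by
  obtain ⟨P, hP⟩ := hL.isExactOn_univ
  replace hP : ∀ z, HasDerivAt P (L z) z := fun z => hP z (Set.mem_univ z)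
  have hPd : Differentiable ℂ P := fun z => (hP z).differentiableAt
  let F : ℂ → (Fin 3 → ℂ) := fun z => (1/2 : ℂ) • γ z - (Complex.I / 2) • P z
  let G : ℂ → (Fin 3 → ℂ) := fun z => (1/2 : ℂ) • γ z + (Complex.I / 2) • P z
  have hF : Differentiable ℂ F := by
    simp only [F]
    fun_prop
  have hG : Differentiable ℂ G := by
    simp only [G]
    fun_prop
  have hXv : ∀ u v : ℝ, X u v =
      F ((u : ℂ) + v * Complex.I) + G ((u : ℂ) + v * (-Complex.I)) := by
    intro u v
    rw [hX, I_smul_intervalIntegral_vertical hL.continuous hP, mul_neg, ← sub_eq_add_neg]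
    simp only [F, G]
    module
  have hXu : ∀ u v : ℝ, X u v =
      F ((v : ℂ) * Complex.I + u * 1) + G ((v : ℂ) * (-Complex.I) + u * 1) := by
    intro u v
    rw [hXv, mul_one, add_comm (u : ℂ), add_comm (u : ℂ)]
  refine ⟨fun u v j => ?_, fun u => ?_, fun u => ?_, fun u v => ?_⟩
  · have hγj : γ ((u : ℂ) - v * Complex.I) j = conj (γ ((u : ℂ) + v * Complex.I) j) := by
      rw [← Differentiable.apply_conj_of_im_ofReal_eq_zero (f := fun z => γ z j)
        (differentiable_pi.1 hγ j) (fun x => hγreal x j)]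
      simp [sub_eq_add_neg]
    have hLj : (∫ s in (-v)..v, L ((u : ℂ) + s * Complex.I)) j =
        ∫ s in (-v)..v, L ((u : ℂ) + s * Complex.I) j := by
      have hLc := hL.continuous
      exact ((ContinuousLinearMap.proj (R := ℂ) (φ := fun _ : Fin 3 => ℂ)
        j).intervalIntegral_comp_comm
          (Continuous.intervalIntegrable (by fun_prop) (-v) v)).symm
    have him := intervalIntegral_vertical_im_eq_zero (f := fun z => L z j)
      (Differentiable.apply_conj_of_im_ofReal_eq_zero (differentiable_pi.1 hL j)
        (fun x => hLreal x j)) u v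
    rw [hX, smul_smul]
    simp only [Pi.sub_apply, Pi.smul_apply, Pi.add_apply, smul_eq_mul, hγj, hLj]
    rw [div_mul_eq_mul_div Complex.I, Complex.I_mul_I, Complex.add_conj]
    simp [him]
  · rw [hX]
    ext j
    simp
    ring
  · have h := (hasDerivAt_comp_real_line hF u Complex.I 0).add
      (hasDerivAt_comp_real_line hG u (-Complex.I) 0)
    have hF' : deriv F u = (1/2 : ℂ) • deriv γ u - (Complex.I / 2) • L u :=
      (((hγ u).hasDerivAt.const_smul (1/2 : ℂ)).sub ((hP u).const_smul (Complex.I / 2))).deriv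
    have hG' : deriv G u = (1/2 : ℂ) • deriv γ u + (Complex.I / 2) • L u :=
      (((hγ u).hasDerivAt.const_smul (1/2 : ℂ)).add ((hP u).const_smul (Complex.I / 2))).deriv
    refine (h.congr_deriv ?_).congr_of_eventuallyEq (.of_forall (hXv u))
    simp only [Complex.ofReal_zero, zero_mul, add_zero, hF', hG']
    ext j
    simp only [Pi.sub_apply, Pi.smul_apply, Pi.add_apply, smul_eq_mul]
    linear_combination (-L u j) * Complex.I_mul_I
  · have h₁ := deriv_deriv_comp_real_line_add hF hG (v * Complex.I) 1 (v * (-Complex.I)) 1 u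
    have h₂ := deriv_deriv_comp_real_line_add hF hG u Complex.I u (-Complex.I) v
    simp only [← hXu] at h₁
    simp only [← hXv] at h₂
    rw [h₁, h₂, mul_one, add_comm ((v : ℂ) * _), add_comm ((v : ℂ) * _), neg_sq, Complex.I_sq]
    module
end

section
/- (Uniform convergence of the maxface sequence.) Let γ : ℂ → ℂ³ be holomorphic, let r > 0, and for n ≥ 1 define L_n(w) := γ'(w) · (1/(n (r+1)ⁿ)) · ∏_{i=1}^{n} (w − 1/i), X_n(u,v) := (1/2)(γ(u+iv) + γ(u−iv)) − (i/2)∫_{[u−iv, u+iv]} L_n(w) dw (complex line integral along the straight segment), and X(u,v) := (1/2)(γ(u+iv) + γ(u−iv)). Let M := sup_{|w| ≤ r} max_j |γ_j'(w)|. Then for every (u,v) with |u+iv| ≤ r and |u−iv| ≤ r, max_j |X_{n,j}(u,v) − X_j(u,v)| ≤ r·M/n. In particular X_n → X uniformly (in the norm ‖·‖_Ω) on any bounded set Ω with Ω̄ ⊆ {(u,v) : |u±iv| ≤ r}. -/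
open Complex in
theorem norm_add_mul_I_le_of_abs_le {u s v : ℝ} (h : |s| ≤ |v|) :
    ‖(u : ℂ) + s * I‖ ≤ ‖(u : ℂ) + v * I‖ := by
  rw [norm_add_mul_I, norm_add_mul_I]
  exact Real.sqrt_le_sqrt (add_le_add_right (sq_le_sq.mpr h) _)

theorem norm_prod_sub_one_div_le {r : ℝ} {w : ℂ} (hw : ‖w‖ ≤ r) (n : ℕ) :
    ‖∏ i ∈ Finset.Icc 1 n, (w - 1 / (i : ℂ))‖ ≤ (r + 1) ^ n := by
  have hfactor : ∀ i ∈ Finset.Icc 1 n, ‖w - 1 / (i : ℂ)‖ ≤ r + 1 := by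
    intro i hi
    have hi1 : (1 : ℝ) ≤ i := by exact_mod_cast (Finset.mem_Icc.mp hi).1
    refine (norm_sub_le _ _).trans (add_le_add hw ?_)
    rw [norm_div, norm_one, Complex.norm_natCast]
    exact (div_le_one (by linarith)).mpr hi1
  rw [norm_prod]
  simpa using Finset.prod_le_prod (fun _ _ => norm_nonneg _) hfactor

theorem norm_normalized_prod_le {r : ℝ} (hr : 0 < r) {w : ℂ} (hw : ‖w‖ ≤ r) (n : ℕ) :
    ‖((1 : ℂ) / ((n : ℂ) * ((r : ℂ) + 1) ^ n)) *
      ∏ i ∈ Finset.Icc 1 n, (w - 1 / (i : ℂ))‖ ≤ 1 / n := by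
  have hnorm : ‖(r : ℂ) + 1‖ = r + 1 := by
    rw [← Complex.ofReal_one, ← Complex.ofReal_add, Complex.norm_real,
      Real.norm_of_nonneg (by linarith)]
  have hpos : 0 < (r + 1) ^ n := by positivity
  rw [norm_mul, norm_div, norm_one, norm_mul, norm_pow, hnorm, Complex.norm_natCast]
  calc 1 / (n * (r + 1) ^ n) * ‖∏ i ∈ Finset.Icc 1 n, (w - 1 / (i : ℂ))‖
      ≤ 1 / (n * (r + 1) ^ n) * (r + 1) ^ n := by
        gcongr
        exact norm_prod_sub_one_div_le hw n
    _ = 1 / n := by rw [← div_div, div_mul_cancel₀ _ hpos.ne']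


/-- Uniform convergence of the maxface sequence: with
`Lₙ(w) = γ'(w)·(1/(n(r+1)ⁿ))·∏_{i=1}^{n}(w − 1/i)`,
`Xₙ(u,v) = (1/2)(γ(u+iv) + γ(u−iv)) − (i/2)∫_{[u−iv,u+iv]} Lₙ(w) dw` (line integral along
the vertical segment, parametrized as `i·∫_{−v}^{v} Lₙ(u+is) ds`) and
`X(u,v) = (1/2)(γ(u+iv) + γ(u−iv))`, if `M` bounds `max_j |γⱼ'|` on `{|w| ≤ r}`, then for
all `(u,v)` with `|u±iv| ≤ r` and every component `j`,
`|Xₙⱼ(u,v) − Xⱼ(u,v)| ≤ rM/n`; in particular `Xₙ → X` uniformly as `rM/n → 0`. -/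
theorem stmt_18 (γ : ℂ → (Fin 3 → ℂ)) (hγ : Differentiable ℂ γ)
    (r : ℝ) (hr : 0 < r) (M : ℝ)
    (hM : ∀ w : ℂ, ‖w‖ ≤ r → ∀ j : Fin 3, ‖deriv γ w j‖ ≤ M) :
    (∀ n : ℕ, 1 ≤ n → ∀ u v : ℝ,
      ‖(u : ℂ) + v * Complex.I‖ ≤ r → ‖(u : ℂ) - v * Complex.I‖ ≤ r → ∀ j : Fin 3,
      ‖(((1/2 : ℂ) • (γ ((u : ℂ) + v * Complex.I) + γ ((u : ℂ) - v * Complex.I))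
            - (Complex.I / 2) •
                (Complex.I • ∫ s in (-v)..v,
                  (((1 : ℂ) / ((n : ℂ) * ((r : ℂ) + 1) ^ n)) *
                    ∏ i ∈ Finset.Icc 1 n, (((u : ℂ) + s * Complex.I) - 1 / (i : ℂ))) •
                      deriv γ ((u : ℂ) + s * Complex.I)))
          - (1/2 : ℂ) • (γ ((u : ℂ) + v * Complex.I) + γ ((u : ℂ) - v * Complex.I))) j‖
        ≤ r * M / n) ∧
    Filter.Tendsto (fun n : ℕ => r * M / n) Filter.atTop (nhds 0) := by
  refine ⟨fun n _ u v huv _ j => ?_, tendsto_const_div_atTop_nhds_zero_nat _⟩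
  have hM0 : 0 ≤ M := (norm_nonneg _).trans (hM 0 (by simpa using hr.le) 0)
  have hv : |v| ≤ r := by simpa using (Complex.abs_im_le_norm _).trans huv
  rw [sub_sub_cancel_left]
  refine (norm_le_pi_norm _ j).trans ?_
  rw [norm_neg, norm_smul, norm_smul, norm_div, Complex.norm_I, one_mul, Complex.norm_ofNat]
  have hint := intervalIntegral.norm_integral_le_of_norm_le_const (a := -v) (b := v)
    (C := 1 / n * M) (f := fun s : ℝ =>
      (((1 : ℂ) / ((n : ℂ) * ((r : ℂ) + 1) ^ n)) *
        ∏ i ∈ Finset.Icc 1 n, (((u : ℂ) + s * Complex.I) - 1 / (i : ℂ))) •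
          deriv γ ((u : ℂ) + s * Complex.I)) (fun s hs => by
      have hsv : |s| ≤ |v| := by
        rcases Set.mem_uIoc.mp hs with h | h
        · exact abs_le_abs h.2 (by linarith)
        · rw [← abs_neg v]
          exact abs_le_abs h.2 (by linarith)
      have hw := (norm_add_mul_I_le_of_abs_le (u := u) hsv).trans huv
      rw [norm_smul]
      exact mul_le_mul (norm_normalized_prod_le hr hw n)
        ((pi_norm_le_iff_of_nonneg hM0).mpr (hM _ hw)) (norm_nonneg _) (by positivity))
  have hlen : |v - -v| = 2 * |v| := by
    rw [sub_neg_eq_add, ← two_mul, abs_mul, abs_two]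
  rw [hlen] at hint
  calc _ ≤ 1 / 2 * (1 / n * M * (2 * |v|)) := mul_le_mul_of_nonneg_left hint (by norm_num)
    _ = |v| * M / n := by ring
    _ ≤ r * M / n := by gcongr
end
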